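/- A group G is an irreducible Wirtinger group if and only if G_ab ≅ ℤ and there is an element a ∈ G satisfying: (1) G coincides with the normal closure of a in G; (2) the homomorphism ζ : C_G(a) → H₂G, g ↦ cls([a|g] − [g|a]), is surjective. -/

import Mathlib

open Finsupp

noncomputable section

universe u

/-- Degree-2 differential of the (unnormalized) inhomogeneous bar complex of `G`
with trivial `ℤ` coefficients: `[g|h] ↦ [h] - [gh] + [g]`. -/
def d2 (G : Type*) [Group G] : ((G × G) →₀ ℤ) →ₗ[ℤ] (G →₀ ℤ) :=
  Finsupp.lift _ ℤ _ fun p => single p.2 1 - single (p.1 * p.2) 1 + single p.1 1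

/-- Degree-3 differential: `[g|h|k] ↦ [h|k] - [gh|k] + [g|hk] - [g|h]`. -/
def d3 (G : Type*) [Group G] : ((G × G × G) →₀ ℤ) →ₗ[ℤ] ((G × G) →₀ ℤ) :=
  Finsupp.lift _ ℤ _ fun t =>
    single (t.2.1, t.2.2) 1 - single (t.1 * t.2.1, t.2.2) 1 +
      single (t.1, t.2.1 * t.2.2) 1 - single (t.1, t.2.1) 1

/-- 2-cycles. -/
def Z2 (G : Type*) [Group G] : Submodule ℤ ((G × G) →₀ ℤ) := LinearMap.ker (d2 G)

/-- 2-boundaries, as a submodule of the 2-cycles. -/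
def B2 (G : Type*) [Group G] : Submodule ℤ (Z2 G) :=
  (LinearMap.range (d3 G)).comap (Z2 G).subtype

/-- The second integral homology of `G`, defined via the inhomogeneous bar complex. -/
abbrev H2 (G : Type*) [Group G] := Z2 G ⧸ B2 G

/-- The homology class of a 2-cycle. -/
def H2cls (G : Type*) [Group G] (z : (G × G) →₀ ℤ) (hz : z ∈ Z2 G) : H2 G :=
  Submodule.Quotient.mk ⟨z, hz⟩

/-- The bar 2-chain `[a|g] - [g|a]`. -/
def barChain (G : Type*) [Group G] (a g : G) : (G × G) →₀ ℤ :=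
  single (a, g) 1 - single (g, a) 1

theorem barChain_mem (G : Type*) [Group G] (a g : G) (h : a * g = g * a) :
    barChain G a g ∈ Z2 G := by
  simp only [Z2, LinearMap.mem_ker, barChain, map_sub, d2, Finsupp.lift_apply]
  rw [sum_single_index, sum_single_index] <;>
    simp [h, sub_add_eq_sub_sub]
  abel

/-- The homology class of the 2-cycle `[a|g] - [g|a]` (defined to be `0` if `a` and `g`
do not commute). -/
def barCls (G : Type*) [Group G] (a g : G) : H2 G :=
  open scoped Classical in
  if h : a * g = g * a then H2cls G (barChain G a g) (barChain_mem G a g h) else 0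

/-- `r` is a Wirtinger relator: it has the form `x_β⁻¹ x_α x_β x_γ⁻¹` for generators
`x_α, x_β, x_γ`. -/
def IsWirtingerRelator {X : Type*} (r : FreeGroup X) : Prop :=
  ∃ α β γ : X,
    r = (FreeGroup.of β)⁻¹ * FreeGroup.of α * FreeGroup.of β * (FreeGroup.of γ)⁻¹

/-- A group is an irreducible Wirtinger group if it admits a presentation on a nonempty
set of generators, all of whose defining relations have the form `x_β⁻¹ x_α x_β = x_γ`,
and in which all the generators are conjugate to each other. -/
def IsIrreducibleWirtingerGroup (G : Type u) [Group G] : Prop :=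
  ∃ (X : Type u) (rels : Set (FreeGroup X)),
    Nonempty X ∧
    (∀ r ∈ rels, IsWirtingerRelator r) ∧
    (∀ x y : X,
      IsConj (PresentedGroup.of (rels := rels) x) (PresentedGroup.of (rels := rels) y)) ∧
    Nonempty (G ≃* PresentedGroup rels)

section BarComplex

variable {G : Type*} [Group G] {M : Type*} [AddCommGroup M]

theorem d2_single (g h : G) :
    d2 G (single (g, h) 1) = single h 1 - single (g * h) 1 + single g 1 := by
  simp [d2, Finsupp.lift_apply]

theorem d3_single (g h k : G) :
    d3 G (single (g, h, k) 1) =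
      single (h, k) 1 - single (g * h, k) 1 + single (g, h * k) 1 - single (g, h) 1 := by
  simp [d3, Finsupp.lift_apply]

theorem barCls_of_commute {a g : G} (h : a * g = g * a) :
    barCls G a g = H2cls G (barChain G a g) (barChain_mem G a g h) :=
  dif_pos h

theorem H2cls_eq_iff {z w : (G × G) →₀ ℤ} (hz : z ∈ Z2 G) (hw : w ∈ Z2 G) :
    H2cls G z hz = H2cls G w hw ↔ ∃ c, d3 G c = z - w := by
  rw [H2cls, H2cls, Submodule.Quotient.eq]
  rfl

theorem H2cls_add {z w : (G × G) →₀ ℤ} (hz : z ∈ Z2 G) (hw : w ∈ Z2 G) :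
    H2cls G (z + w) (add_mem hz hw) = H2cls G z hz + H2cls G w hw :=
  rfl

theorem barCls_mul {a g h : G} (hg : a * g = g * a) (hh : a * h = h * a) :
    barCls G a (g * h) = barCls G a g + barCls G a h := by
  have hgh : a * (g * h) = g * h * a := by rw [← mul_assoc, hg, mul_assoc, hh, mul_assoc]
  rw [barCls_of_commute hg, barCls_of_commute hh, barCls_of_commute hgh, ← H2cls_add,
    H2cls_eq_iff]
  refine ⟨single (a, g, h) 1 + single (g, h, a) 1 - single (g, a, h) 1, ?_⟩
  simp only [map_add, map_sub, d3_single, barChain, hg, hh]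
  abel

/-- The homomorphism `ζ : C_G(a) → H₂ G`, `g ↦ cls([a|g] - [g|a])`. -/
def barHom (a : G) : Additive (Subgroup.centralizer {a}) →+ H2 G :=
  AddMonoidHom.mk' (fun g => barCls G a (g.toMul : G)) fun g h =>
    barCls_mul (Subgroup.mem_centralizer_singleton_iff.1 g.toMul.2).symm
      (Subgroup.mem_centralizer_singleton_iff.1 h.toMul.2).symm

/-- A linear map on 2-chains vanishing on boundaries and on all the cycles `[a|g] - [g|a]`
vanishes on all 2-cycles, provided the latter represent all of `H₂ G`. -/
theorem eq_zero_of_mem_Z2 {a : G}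
    (ha : ∀ h : H2 G, ∃ g ∈ Subgroup.centralizer {a}, h = barCls G a g)
    (F : ((G × G) →₀ ℤ) →ₗ[ℤ] M) (hF : F ∘ₗ d3 G = 0)
    (hFa : ∀ g, a * g = g * a → F (barChain G a g) = 0)
    {z : (G × G) →₀ ℤ} (hz : z ∈ Z2 G) : F z = 0 := by
  obtain ⟨g, hg, h⟩ := ha (H2cls G z hz)
  have hag : a * g = g * a := (Subgroup.mem_centralizer_singleton_iff.1 hg).symm
  rw [barCls_of_commute hag, H2cls_eq_iff] at h
  obtain ⟨c, hc⟩ := h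
  have := LinearMap.congr_fun hF c
  rw [LinearMap.comp_apply, hc, map_sub, hFa g hag, sub_zero] at this
  exact this

theorem normalClosure_singleton_hom_trivial {H : Type*} [Group H] {a : G}
    (ha : Subgroup.normalClosure {a} = ⊤) (φ : G →* H) (hφ : φ a = 1) (g : G) : φ g = 1 := by
  have h : Subgroup.normalClosure {a} ≤ φ.ker :=
    Subgroup.normalClosure_le_normal (by simpa using hφ)
  rw [ha] at h
  exact h (Subgroup.mem_top g)

/-- Modulo boundaries, every 1-chain `[g]` is a multiple of `[a]` when `a` normally generates. -/
theorem exists_single_eq_d2_add {a : G} (ha : Subgroup.normalClosure {a} = ⊤) (g : G) :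
    ∃ (c : (G × G) →₀ ℤ) (n : ℤ), single g 1 = d2 G c + n • single a 1 := by
  let N : Submodule ℤ (G →₀ ℤ) := LinearMap.range (d2 G) ⊔ Submodule.span ℤ {single a 1}
  let ψ : G →* Multiplicative ((G →₀ ℤ) ⧸ N) :=
    MonoidHom.mk' (fun g => Multiplicative.ofAdd (N.mkQ (single g 1))) fun g h => by
      rw [← ofAdd_add, ← map_add]
      congr 1
      rw [Submodule.mkQ_apply, Submodule.mkQ_apply, Submodule.Quotient.eq]
      refine Submodule.mem_sup_left ⟨-single (g, h) 1, ?_⟩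
      rw [map_neg, d2_single]
      abel
  have h1 : ∀ g, ψ g = 1 ↔ single g 1 ∈ N := fun g =>
    (Submodule.Quotient.mk_eq_zero N (x := single g 1))
  have h2 := (h1 g).1 (normalClosure_singleton_hom_trivial ha ψ
    ((h1 a).2 (Submodule.mem_sup_right (Submodule.mem_span_singleton_self _))) g)
  obtain ⟨_, ⟨c, rfl⟩, _, hy, h⟩ := Submodule.mem_sup.1 h2
  obtain ⟨n, rfl⟩ := Submodule.mem_span_singleton.1 hy
  exact ⟨c, n, h.symm⟩

theorem eq_zero_of_d2_eq_smul_single {a : G} (φ : G →* Multiplicative ℤ) (hφ : φ a ≠ 1)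
    {c : (G × G) →₀ ℤ} {n : ℤ} (h : d2 G c = n • single a 1) : n = 0 := by
  let Φ : (G →₀ ℤ) →ₗ[ℤ] ℤ := Finsupp.lift _ ℤ _ fun g => (φ g).toAdd
  have hΦ : ∀ g, Φ (single g 1) = (φ g).toAdd := fun g => by simp [Φ, Finsupp.lift_apply]
  have h0 : Φ ∘ₗ d2 G = 0 := by
    ext ⟨g, k⟩
    simp only [LinearMap.comp_apply, lsingle_apply, d2_single, map_add, map_sub, hΦ, map_mul,
      toAdd_mul, LinearMap.zero_apply]
    ring
  have h1 := LinearMap.congr_fun h0 c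
  rw [LinearMap.comp_apply, h, map_smul, hΦ, smul_eq_mul, LinearMap.zero_apply] at h1
  exact (mul_eq_zero.1 h1).resolve_right fun h => hφ (Multiplicative.toAdd.injective h)

/-- If `a` normally generates `G` and has infinite order in the abelianization, the differential
`d2` is split by a map sending `[a]` to a cycle. -/
theorem exists_splitting_d2 {a : G} (ha : Subgroup.normalClosure {a} = ⊤)
    (φ : G →* Multiplicative ℤ) (hφ : φ a ≠ 1) :
    ∃ s : (G →₀ ℤ) →ₗ[ℤ] ((G × G) →₀ ℤ),
      (∀ c, c - s (d2 G c) ∈ Z2 G) ∧ s (single a 1) ∈ Z2 G := by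
  choose c n hcn using exists_single_eq_d2_add ha
  let s : (G →₀ ℤ) →ₗ[ℤ] ((G × G) →₀ ℤ) := Finsupp.lift _ ℤ _ c
  let ν : (G →₀ ℤ) →ₗ[ℤ] ℤ := Finsupp.lift _ ℤ _ n
  have hs : ∀ g, s (single g 1) = c g := fun g => by simp [s, Finsupp.lift_apply]
  have hν : ∀ g, ν (single g 1) = n g := fun g => by simp [ν, Finsupp.lift_apply]
  have hds : ∀ x, d2 G (s x) = x - ν x • single a 1 := by
    intro x
    have : d2 G ∘ₗ s = LinearMap.id - ν.smulRight (single a 1) := by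
      ext g : 2
      simp only [LinearMap.comp_apply, lsingle_apply, LinearMap.sub_apply, LinearMap.id_apply,
        LinearMap.smulRight_apply, hs, hν]
      rw [eq_sub_iff_add_eq, ← hcn g]
    exact LinearMap.congr_fun this x
  refine ⟨s, fun c => ?_, ?_⟩
  · have h0 : d2 G (c - s (d2 G c)) = ν (d2 G c) • single a 1 := by
      rw [map_sub, hds, sub_sub_cancel]
    rwa [eq_zero_of_d2_eq_smul_single φ hφ h0, zero_smul] at h0
  · have h0 : d2 G (s (single a 1)) = (1 - n a) • single a 1 := by
      rw [hds, hν, sub_smul, one_smul]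
    rwa [eq_zero_of_d2_eq_smul_single φ hφ h0, zero_smul] at h0

/-- If `a` normally generates `G` and has infinite order in the abelianization, a linear map on
2-chains vanishing on cycles is the coboundary of a function vanishing at `a`. -/
theorem exists_coboundary {a : G} (ha : Subgroup.normalClosure {a} = ⊤)
    (φ : G →* Multiplicative ℤ) (hφ : φ a ≠ 1) (F : ((G × G) →₀ ℤ) →ₗ[ℤ] M)
    (hF : ∀ z ∈ Z2 G, F z = 0) :
    ∃ t : G → M, t a = 0 ∧ ∀ g h, F (single (g, h) 1) = t h - t (g * h) + t g := by
  obtain ⟨s, hs, hsa⟩ := exists_splitting_d2 ha φ hφ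
  refine ⟨fun g => F (s (single g 1)), hF _ hsa, fun g h => ?_⟩
  have h0 := hF _ (hs (single (g, h) 1))
  rw [d2_single, map_sub, map_add, map_sub, map_add, map_sub] at h0
  exact sub_eq_zero.1 h0

/-- If `a` normally generates `G` and has infinite order in the abelianization, every homomorphism
on 2-cycles extends to 2-chains. -/
theorem exists_extend_Z2 {a : G} (ha : Subgroup.normalClosure {a} = ⊤)
    (φ : G →* Multiplicative ℤ) (hφ : φ a ≠ 1) (q : Z2 G →ₗ[ℤ] M) :
    ∃ F : ((G × G) →₀ ℤ) →ₗ[ℤ] M, F ∘ₗ (Z2 G).subtype = q := by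
  obtain ⟨s, hs, -⟩ := exists_splitting_d2 ha φ hφ
  refine ⟨q ∘ₗ (LinearMap.id - s ∘ₗ d2 G).codRestrict (Z2 G) hs,
    LinearMap.ext fun z => congrArg q (Subtype.ext ?_)⟩
  have hz : d2 G (z : (G × G) →₀ ℤ) = 0 := z.2
  simp [hz]

end BarComplex

section CentralExtension

variable {G E : Type*} [Group G] [Group E]

/-- A central extension of `G` splits, with prescribed value of the section at the normal
generator `a`, when every lift of the centralizer of `a` commutes with the lift of `a` and the
classes `[a|g] - [g|a]` exhaust `H₂ G`. -/
theorem exists_section_of_barCls_surjective {a : G} (ha : Subgroup.normalClosure {a} = ⊤)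
    (φ : G →* Multiplicative ℤ) (hφ : φ a ≠ 1)
    (hsurj : ∀ h : H2 G, ∃ g ∈ Subgroup.centralizer {a}, h = barCls G a g)
    (π : E →* G) (hπ : Function.Surjective π) (hker : π.ker ≤ Subgroup.center E)
    (u : E) (hu : π u = a) (hcomm : ∀ x, a * π x = π x * a → u * x = x * u) :
    ∃ s : G →* E, (∀ g, π (s g) = g) ∧ s a = u := by
  classical
  have hz : ∀ (z : π.ker) (x : E), (z : E) * x = x * z := fun z x =>
    (Subgroup.mem_center_iff.1 (hker z.2) x).symm
  let _ : CommGroup π.ker :=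
    { (inferInstance : Group π.ker) with mul_comm := fun y z => Subtype.ext (hz y z) }
  obtain ⟨σ, hσ, hσa⟩ : ∃ σ : G → E, (∀ g, π (σ g) = g) ∧ σ a = u := by
    choose σ hσ using hπ
    refine ⟨Function.update σ a u, fun g => ?_, Function.update_self ..⟩
    by_cases h : g = a
    · subst h; simpa using hu
    · rw [Function.update_of_ne h, hσ]
  let f : G → G → π.ker := fun g h =>
    ⟨(σ (g * h))⁻¹ * (σ g * σ h), by simp [MonoidHom.mem_ker, hσ]⟩
  have hf : ∀ g h, σ g * σ h = σ (g * h) * f g h := fun g h => by simp [f]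
  have hcocycle : ∀ g h k, f g h * f (g * h) k = f h k * f g (h * k) := fun g h k => by
    apply Subtype.ext
    have h1 : σ g * σ h * σ k = σ (g * h * k) * ((f g h : E) * f (g * h) k) := by
      rw [hf, mul_assoc, hz, ← mul_assoc, hf, mul_assoc, ← hz (f g h)]
    have h2 : σ g * σ h * σ k = σ (g * h * k) * ((f h k : E) * f g (h * k)) := by
      rw [mul_assoc, hf h k, ← mul_assoc, hf g (h * k), mul_assoc, ← hz (f h k), mul_assoc g h k]
    exact mul_left_cancel (h1.symm.trans h2)
  let F : ((G × G) →₀ ℤ) →ₗ[ℤ] Additive π.ker :=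
    Finsupp.lift _ ℤ _ fun p => Additive.ofMul (f p.1 p.2)
  have hF : ∀ g h, F (single (g, h) 1) = Additive.ofMul (f g h) := fun g h => by
    simp [F, Finsupp.lift_apply]
  have hFd : F ∘ₗ d3 G = 0 := by
    ext ⟨g, h, k⟩ : 2
    have := congrArg Additive.ofMul (hcocycle g h k)
    rw [ofMul_mul, ofMul_mul] at this
    simp only [LinearMap.comp_apply, lsingle_apply, d3_single, map_add, map_sub, hF,
      LinearMap.zero_apply]
    rw [sub_add_eq_add_sub, ← this]
    abel
  have hFa : ∀ g, a * g = g * a → F (barChain G a g) = 0 := fun g hg => by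
    rw [barChain, map_sub, hF, hF, sub_eq_zero]
    congr 1
    apply Subtype.ext
    have := hcomm (σ g) (by rwa [hσ])
    simp only [f, hσa, this, hg]
  obtain ⟨t, hta, ht⟩ := exists_coboundary ha φ hφ F
    fun z hz => eq_zero_of_mem_Z2 hsurj F hFd hFa hz
  have ht' : ∀ g h, f g h * (t (g * h)).toMul = (t h).toMul * (t g).toMul := fun g h => by
    apply Additive.ofMul.injective
    rw [ofMul_mul, ← hF, ht, ofMul_mul]
    simp only [ofMul_toMul]
    abel
  refine ⟨MonoidHom.mk' (fun g => σ g * ((t g).toMul : π.ker)⁻¹) fun g h => ?_, fun g => ?_, ?_⟩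
  · have h1 : (((t g).toMul⁻¹ : π.ker) : E) * σ h = σ h * (((t g).toMul⁻¹ : π.ker) : E) :=
      hz (t g).toMul⁻¹ (σ h)
    have h2 : (f g h : E) * (t (g * h)).toMul = (t h).toMul * (t g).toMul :=
      congrArg Subtype.val (ht' g h)
    rw [mul_assoc, ← mul_assoc _ (σ h), h1, mul_assoc (σ h), ← mul_assoc (σ g), hf, mul_assoc,
      InvMemClass.coe_inv, InvMemClass.coe_inv, InvMemClass.coe_inv, ← mul_inv_rev, ← h2,
      mul_inv_rev, ← mul_assoc (f g h : E), hz (f g h), mul_inv_cancel_right]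
  · have : π (((t g).toMul : π.ker) : E) = 1 := (t g).toMul.2
    simp [hσ, this]
  · simp [hta, hσa]

/-- The extension of `G` by an abelian group `M` given by a 2-cocycle `f`, with underlying set
`M × G` and multiplication `(m, g) (n, h) = (m + n + f g h, g h)`. -/
@[ext]
structure CocycleExtension {G M : Type*} [Group G] [AddCommGroup M] (f : G → G → M)
    (hf : ∀ g h k, f h k - f (g * h) k + f g (h * k) - f g h = 0) where
  fst : M
  snd : G

namespace CocycleExtension

variable {M : Type*} [AddCommGroup M] {f : G → G → M}
  {hf : ∀ g h k, f h k - f (g * h) k + f g (h * k) - f g h = 0}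

instance : Mul (CocycleExtension f hf) :=
  ⟨fun x y => ⟨x.fst + y.fst + f x.snd y.snd, x.snd * y.snd⟩⟩

instance : One (CocycleExtension f hf) := ⟨⟨-f 1 1, 1⟩⟩

instance : Inv (CocycleExtension f hf) :=
  ⟨fun x => ⟨-x.fst - f x.snd⁻¹ x.snd - f 1 1, x.snd⁻¹⟩⟩

theorem mul_def (x y : CocycleExtension f hf) :
    x * y = ⟨x.fst + y.fst + f x.snd y.snd, x.snd * y.snd⟩ :=
  rfl

instance : Group (CocycleExtension f hf) :=
  Group.ofLeftAxioms
    (fun x y z => by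
      ext
      · have h1 := sub_eq_zero.1 (hf x.snd y.snd z.snd)
        simp only [mul_def, ← h1]
        abel
      · exact mul_assoc ..)
    (fun x => by
      ext
      · have h1 := sub_eq_zero.1 (hf 1 1 x.snd)
        rw [one_mul, one_mul, sub_self, zero_add] at h1
        change -f 1 1 + x.fst + f 1 x.snd = _
        rw [h1]
        abel
      · exact one_mul _)
    (fun x => by
      ext
      · change -x.fst - f x.snd⁻¹ x.snd - f 1 1 + x.fst + f x.snd⁻¹ x.snd = -f 1 1
        abel
      · exact inv_mul_cancel _)

/-- The projection of a cocycle extension onto the base group. -/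
def proj : CocycleExtension f hf →* G := MonoidHom.mk' snd fun _ _ => rfl

end CocycleExtension

/-- If every central extension in which the centralizer of `a` lifts to the centralizer of a lift
of `a` splits, then the classes `[a|g] - [g|a]` exhaust `H₂ G`. -/
theorem barCls_surjective_of_exists_section {G : Type u} [Group G] {a : G}
    (ha : Subgroup.normalClosure {a} = ⊤) (φ : G →* Multiplicative ℤ) (hφ : φ a ≠ 1)
    (H : ∀ (E : Type u) [Group E] (π : E →* G), Function.Surjective π →
      ∀ u : E, π u = a → (∀ x, a * π x = π x * a → u * x = x * u) →
        ∃ s : G →* E, ∀ g, π (s g) = g) (h : H2 G) :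
    ∃ g ∈ Subgroup.centralizer {a}, h = barCls G a g := by
  let R : Submodule ℤ (H2 G) := AddSubgroup.toIntSubmodule (barHom a).range
  obtain ⟨F, hF⟩ := exists_extend_Z2 ha φ hφ (R.mkQ ∘ₗ (B2 G).mkQ)
  have hF' : ∀ (z) (hz : z ∈ Z2 G), F z = R.mkQ (H2cls G z hz) := fun z hz =>
    LinearMap.congr_fun hF ⟨z, hz⟩
  have hdd : ∀ c, d3 G c ∈ Z2 G := fun c => by
    have : d2 G ∘ₗ d3 G = 0 := by
      ext ⟨g, h, k⟩ : 2
      simp only [LinearMap.comp_apply, lsingle_apply, d3_single, map_add, map_sub, d2_single,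
        LinearMap.zero_apply, mul_assoc]
      abel
    exact LinearMap.congr_fun this c
  have hFd : ∀ c, F (d3 G c) = 0 := fun c => by
    have : H2cls G (d3 G c) (hdd c) = 0 :=
      (H2cls_eq_iff (hdd c) (zero_mem _)).2 ⟨c, (sub_zero _).symm⟩
    rw [hF' _ (hdd c), this, map_zero]
  let f : G → G → H2 G ⧸ R := fun g h => F (single (g, h) 1)
  have hf : ∀ g h k, f h k - f (g * h) k + f g (h * k) - f g h = 0 := fun g h k => by
    have := hFd (single (g, h, k) 1)
    rwa [d3_single, map_sub, map_add, map_sub] at this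
  have hfa : ∀ g, a * g = g * a → f a g = f g a := fun g hg => by
    have h1 : F (barChain G a g) = 0 := by
      rw [hF' _ (barChain_mem G a g hg), ← barCls_of_commute hg]
      exact (Submodule.Quotient.mk_eq_zero R).2
        ⟨Additive.ofMul ⟨g, Subgroup.mem_centralizer_singleton_iff.2 hg.symm⟩, rfl⟩
    rw [barChain, map_sub] at h1
    exact sub_eq_zero.1 h1
  obtain ⟨s, hs⟩ := H (CocycleExtension f hf) CocycleExtension.proj (fun g => ⟨⟨0, g⟩, rfl⟩)
    ⟨0, a⟩ rfl fun x hx => by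
      have hx' : a * x.snd = x.snd * a := hx
      rw [CocycleExtension.mul_def, CocycleExtension.mul_def, hfa _ hx', hx', zero_add, add_zero]
  let T : (G →₀ ℤ) →ₗ[ℤ] H2 G ⧸ R := Finsupp.lift _ ℤ _ fun g => (s g).fst
  have hT : ∀ g, T (single g 1) = (s g).fst := fun g => by simp [T, Finsupp.lift_apply]
  have hFT : F = -(T ∘ₗ d2 G) := by
    ext ⟨g, k⟩ : 2
    have h1 : (s (g * k)).fst = (s g).fst + (s k).fst + f (s g).snd (s k).snd := by
      rw [map_mul]; rfl
    rw [show (s g).snd = g from hs g, show (s k).snd = k from hs k] at h1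
    simp only [LinearMap.comp_apply, lsingle_apply, LinearMap.neg_apply, d2_single, map_add,
      map_sub, hT, h1]
    change f g k = _
    abel
  obtain ⟨⟨z, hz⟩, rfl⟩ := Submodule.Quotient.mk_surjective _ h
  have h0 : R.mkQ (H2cls G z hz) = 0 := by
    rw [← hF' z hz, hFT, LinearMap.neg_apply, LinearMap.comp_apply, LinearMap.mem_ker.1 hz,
      map_zero, neg_zero]
  obtain ⟨g, hg⟩ := (Submodule.Quotient.mk_eq_zero R).1 h0
  exact ⟨g.toMul, g.toMul.2, hg.symm⟩

end CentralExtension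

section Wirtinger

/-- A group presented by Wirtinger relations with generators conjugate to `a` is projective with
respect to surjections along which the centralizer of `a` lifts to the centralizer of a lift of
`a`. -/
theorem PresentedGroup.exists_section_of_wirtinger {X : Type*} {rels : Set (FreeGroup X)}
    (hrels : ∀ r ∈ rels, IsWirtingerRelator r) {a : PresentedGroup rels}
    (ha : ∀ x : X, IsConj a (PresentedGroup.of x))
    {E : Type*} [Group E] (π : E →* PresentedGroup rels) (hπ : Function.Surjective π)
    (u : E) (hu : π u = a) (hcomm : ∀ x, a * π x = π x * a → u * x = x * u) :
    ∃ s : PresentedGroup rels →* E, ∀ g, π (s g) = g := by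
  have hlift : ∀ x : X, ∃ w : E, π (w * u * w⁻¹) = PresentedGroup.of x := fun x => by
    obtain ⟨c, hc⟩ := isConj_iff.1 (ha x)
    obtain ⟨w, rfl⟩ := hπ c
    exact ⟨w, by simpa [hu] using hc⟩
  choose w hw using hlift
  have hinj : ∀ v v' : E, π (v * u * v⁻¹) = π (v' * u * v'⁻¹) → v * u * v⁻¹ = v' * u * v'⁻¹ :=
    fun v v' h => by
      have h1 : u * (v'⁻¹ * v) = v'⁻¹ * v * u := by
        apply hcomm
        simp only [map_mul, map_inv, hu] at h ⊢
        rw [mul_inv_eq_iff_eq_mul] at h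
        rw [mul_assoc _ (π v), h]
        group
      rw [mul_inv_eq_iff_eq_mul, ← mul_right_inj v'⁻¹, ← mul_assoc, ← h1]
      group
  have hrel : ∀ r ∈ rels, FreeGroup.lift (fun x => w x * u * (w x)⁻¹) r = 1 := fun r hr => by
    obtain ⟨α, β, γ, rfl⟩ := hrels r hr
    have h0 := PresentedGroup.one_of_mem hr
    rw [map_mul, map_inv, mul_inv_eq_one] at h0
    simp only [map_mul, map_inv, FreeGroup.lift_apply_of]
    rw [mul_inv_eq_one]
    set b := w β * u * (w β)⁻¹ with hb
    have h1 : b⁻¹ * (w α * u * (w α)⁻¹) * b = b⁻¹ * w α * u * (b⁻¹ * w α)⁻¹ := by group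
    rw [h1]
    apply hinj
    rw [← h1, map_mul, map_mul, map_inv, hb, hw, hw, hw]
    rwa [map_mul, map_mul, map_inv] at h0
  refine ⟨PresentedGroup.toGroup hrel, fun g => ?_⟩
  have : π.comp (PresentedGroup.toGroup hrel) = MonoidHom.id _ := by
    ext x
    simpa using hw x
  exact DFunLike.congr_fun this g

/-- The Wirtinger relators on a conjugacy class of `G` recording conjugation in `G`. -/
def conjRels {G : Type*} [Group G] (a : G) : Set (FreeGroup {x : G // IsConj a x}) :=
  {r | ∃ x y z : {x : G // IsConj a x}, (y : G)⁻¹ * x * y = z ∧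
    r = (FreeGroup.of y)⁻¹ * FreeGroup.of x * FreeGroup.of y * (FreeGroup.of z)⁻¹}

variable {G : Type u} [Group G]

/-- The canonical map to `G` from the group presented by the conjugation relations on a
conjugacy class. -/
def conjRelsHom (a : G) : PresentedGroup (conjRels a) →* G :=
  PresentedGroup.toGroup (f := Subtype.val) (by
    rintro r ⟨x, y, z, h, rfl⟩
    simp [h])

theorem conjRelsHom_of (a : G) (x : {x : G // IsConj a x}) :
    conjRelsHom a (PresentedGroup.of x) = x :=
  PresentedGroup.toGroup.of _

theorem conjRels_conj_of (a : G) (p : PresentedGroup (conjRels a))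
    (x z : {x : G // IsConj a x}) (h : (conjRelsHom a p)⁻¹ * x * conjRelsHom a p = z) :
    p⁻¹ * PresentedGroup.of x * p = PresentedGroup.of z := by
  have hp : p ∈ Subgroup.closure (Set.range (PresentedGroup.of (rels := conjRels a))) := by
    rw [PresentedGroup.closure_range_of]; exact Subgroup.mem_top p
  induction hp using Subgroup.closure_induction generalizing x z with
  | mem p hp =>
    obtain ⟨y, rfl⟩ := hp
    rw [conjRelsHom_of] at h
    have h0 := PresentedGroup.one_of_mem (rels := conjRels a) ⟨x, y, z, h, rfl⟩
    rw [map_mul, map_inv, mul_inv_eq_one] at h0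
    rwa [map_mul, map_mul, map_inv] at h0
  | one =>
    have : x = z := Subtype.ext (by simpa using h)
    simp [this]
  | mul p q _ _ ihp ihq =>
    let y : {x : G // IsConj a x} := ⟨(conjRelsHom a p)⁻¹ * x * conjRelsHom a p,
      x.2.trans (isConj_iff.2 ⟨(conjRelsHom a p)⁻¹, by simp⟩)⟩
    rw [← ihq y z (by rw [← h, map_mul]; simp only [y]; group), ← ihp x y rfl]
    group
  | inv p _ ih =>
    rw [← ih z x (by rw [← h, map_inv]; group)]
    group

theorem conjRelsHom_surjective {a : G} (ha : Subgroup.normalClosure {a} = ⊤) :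
    Function.Surjective (conjRelsHom a) := by
  rw [← MonoidHom.range_eq_top, eq_top_iff, ← ha, Subgroup.normalClosure, Subgroup.closure_le]
  intro x hx
  obtain ⟨_, rfl, hax⟩ := Group.mem_conjugatesOfSet_iff.1 hx
  exact ⟨PresentedGroup.of ⟨x, hax⟩, conjRelsHom_of _ _⟩

theorem conjRelsHom_ker_le_center (a : G) :
    (conjRelsHom a).ker ≤ Subgroup.center (PresentedGroup (conjRels a)) := by
  intro z hz
  rw [Subgroup.mem_center_iff]
  intro p
  rw [← Subgroup.mem_centralizer_singleton_iff]
  refine PresentedGroup.generated_by _ (Subgroup.centralizer {z}) (fun x => ?_) p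
  have := conjRels_conj_of a z x x (by rw [MonoidHom.mem_ker.1 hz]; simp)
  rwa [mul_assoc, inv_mul_eq_iff_eq_mul, ← Subgroup.mem_centralizer_singleton_iff] at this

theorem conjRels_isConj {a : G} (ha : Subgroup.normalClosure {a} = ⊤)
    (x y : {x : G // IsConj a x}) :
    IsConj (PresentedGroup.of (rels := conjRels a) x)
      (PresentedGroup.of (rels := conjRels a) y) := by
  obtain ⟨c, hc⟩ := isConj_iff.1 (x.2.symm.trans y.2)
  obtain ⟨p, hp⟩ := conjRelsHom_surjective ha c⁻¹
  refine isConj_iff.2 ⟨p⁻¹, ?_⟩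
  rw [inv_inv]
  exact conjRels_conj_of a p x y (by rw [hp, inv_inv, hc])

theorem isIrreducibleWirtingerGroup_of_barCls_surjective {a : G}
    (ha : Subgroup.normalClosure {a} = ⊤) (φ : G →* Multiplicative ℤ) (hφ : φ a ≠ 1)
    (hsurj : ∀ h : H2 G, ∃ g ∈ Subgroup.centralizer {a}, h = barCls G a g) :
    IsIrreducibleWirtingerGroup G := by
  let a' : {x : G // IsConj a x} := ⟨a, IsConj.refl a⟩
  obtain ⟨s, hs, hsa⟩ := exists_section_of_barCls_surjective ha φ hφ hsurj (conjRelsHom a)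
    (conjRelsHom_surjective ha) (conjRelsHom_ker_le_center a) (PresentedGroup.of a')
    (conjRelsHom_of a a') fun x hx => by
      rw [← inv_mul_eq_iff_eq_mul, ← mul_assoc]
      exact conjRels_conj_of a x a' a' (by rw [mul_assoc, inv_mul_eq_iff_eq_mul]; exact hx)
  have hs_surj : Function.Surjective s := by
    rw [← MonoidHom.range_eq_top, eq_top_iff]
    intro p _
    refine PresentedGroup.generated_by _ s.range (fun x => ?_) p
    obtain ⟨c, hc⟩ := isConj_iff.1 x.2
    rw [← conjRels_conj_of a (s c⁻¹) a' x (by rw [hs, inv_inv]; exact hc), ← hsa, ← map_inv,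
      ← map_mul, ← map_mul]
    exact ⟨_, rfl⟩
  refine ⟨_, conjRels a, ⟨a'⟩, ?_, conjRels_isConj ha,
    ⟨MulEquiv.ofBijective s ⟨(Function.LeftInverse.injective hs), hs_surj⟩⟩⟩
  rintro r ⟨x, y, z, -, rfl⟩
  exact ⟨x, y, z, rfl⟩

/-- The degree homomorphism of a Wirtinger presentation. -/
theorem PresentedGroup.exists_degree {X : Type*} {rels : Set (FreeGroup X)}
    (hrels : ∀ r ∈ rels, IsWirtingerRelator r) :
    ∃ deg : PresentedGroup rels →* Multiplicative ℤ,
      ∀ x, deg (PresentedGroup.of x) = Multiplicative.ofAdd 1 := by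
  have h : ∀ r ∈ rels, FreeGroup.lift (fun _ : X => Multiplicative.ofAdd (1 : ℤ)) r = 1 :=
    fun r hr => by
      obtain ⟨α, β, γ, rfl⟩ := hrels r hr
      simp
  exact ⟨PresentedGroup.toGroup h, fun x => PresentedGroup.toGroup.of h⟩

theorem PresentedGroup.abelianization_of_wirtinger {X : Type*} {rels : Set (FreeGroup X)}
    (hrels : ∀ r ∈ rels, IsWirtingerRelator r) (x₀ : X)
    (hconj : ∀ x : X, IsConj (PresentedGroup.of (rels := rels) x₀) (PresentedGroup.of x)) :
    Nonempty (Abelianization (PresentedGroup rels) ≃* Multiplicative ℤ) := by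
  obtain ⟨deg, hdeg⟩ := PresentedGroup.exists_degree hrels
  let A := Abelianization (PresentedGroup rels)
  let b : A := Abelianization.of (PresentedGroup.of x₀)
  let ψ : Multiplicative ℤ →* A := zpowersHom A b
  refine ⟨MonoidHom.toMulEquiv (Abelianization.lift deg) ψ ?_ ?_⟩
  · ext x
    have : Abelianization.of (PresentedGroup.of (rels := rels) x) = b :=
      (isConj_iff_eq.1 (Abelianization.of.map_isConj (hconj x))).symm
    rw [MonoidHom.comp_apply, MonoidHom.comp_apply, Abelianization.lift_apply_of, hdeg]
    simpa [ψ] using this.symm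
  · ext
    simp [ψ, b, hdeg]

theorem PresentedGroup.normalClosure_of_eq_top {X : Type*} {rels : Set (FreeGroup X)} (x₀ : X)
    (hconj : ∀ x : X, IsConj (PresentedGroup.of (rels := rels) x₀) (PresentedGroup.of x)) :
    Subgroup.normalClosure {PresentedGroup.of (rels := rels) x₀} = ⊤ := by
  rw [eq_top_iff]
  intro p _
  refine PresentedGroup.generated_by _ _ (fun x => ?_) p
  exact Subgroup.conjugatesOfSet_subset_normalClosure
    (Group.mem_conjugatesOfSet_iff.2 ⟨_, rfl, hconj x⟩)

end Wirtinger

/-- Kuz'min's characterization of irreducible Wirtinger groups: `G` is an irreducible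
Wirtinger group if and only if its abelianization is infinite cyclic and there is an
element `a ∈ G` such that (1) `G` is the normal closure of `a` and (2) the homomorphism
`ζ : C_G(a) → H₂G, g ↦ [a|g] - [g|a]` is surjective. -/
theorem isIrreducibleWirtingerGroup_iff (G : Type u) [Group G] :
    IsIrreducibleWirtingerGroup G ↔
      Nonempty (Additive (Abelianization G) ≃+ ℤ) ∧
      ∃ a : G,
        Subgroup.normalClosure {a} = ⊤ ∧
        ∀ h : H2 G, ∃ g ∈ Subgroup.centralizer {a}, h = barCls G a g := by
  constructor
  · rintro ⟨X, rels, ⟨x₀⟩, hrels, hconj, ⟨e⟩⟩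
    obtain ⟨f⟩ := PresentedGroup.abelianization_of_wirtinger hrels x₀ (hconj x₀)
    obtain ⟨deg, hdeg⟩ := PresentedGroup.exists_degree hrels
    have ha : Subgroup.normalClosure {e.symm (PresentedGroup.of x₀)} = ⊤ := by
      have h := congrArg (Subgroup.map e.symm.toMonoidHom)
        (PresentedGroup.normalClosure_of_eq_top x₀ (hconj x₀))
      rw [Subgroup.map_normalClosure _ _ e.symm.surjective, Set.image_singleton,
        Subgroup.map_top_of_surjective _ e.symm.surjective] at h
      exact h
    refine ⟨⟨MulEquiv.toAdditiveLeft (e.abelianizationCongr.trans f)⟩,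
      e.symm (PresentedGroup.of x₀), ha, ?_⟩
    refine barCls_surjective_of_exists_section ha (deg.comp e.toMonoidHom)
      (by simp [hdeg]) fun E _ π hπ u hu hcomm => ?_
    obtain ⟨s, hs⟩ := PresentedGroup.exists_section_of_wirtinger hrels (hconj x₀)
      (e.toMonoidHom.comp π) (e.surjective.comp hπ) u (by simp [hu]) fun x hx =>
        hcomm x (e.injective (by simpa using hx))
    exact ⟨s.comp e.toMonoidHom, fun g => e.injective (hs (e g))⟩
  · rintro ⟨⟨f⟩, a, ha, hsurj⟩
    let φ : G →* Multiplicative ℤ :=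
      (AddMonoidHom.toMultiplicativeRight f.toAddMonoidHom).comp Abelianization.of
    refine isIrreducibleWirtingerGroup_of_barCls_surjective ha φ (fun h => ?_) hsurj
    have h1 := normalClosure_singleton_hom_trivial ha φ h
    obtain ⟨y, hy⟩ := f.surjective 1
    obtain ⟨g, hg⟩ := QuotientGroup.mk_surjective y.toMul
    have h2 : f (Additive.ofMul (Abelianization.of g)) = 0 := h1 g
    rw [show Abelianization.of g = y.toMul from hg, ofMul_toMul, hy] at h2
    exact one_ne_zero h2

end
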